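/- arXiv:math/9406212 — 2 statements merged into one kernel-verified Lean document; each statement's English description precedes it below -/
import Mathlib

section
/- Let $(\Omega,\Sigma,\mu)$ be a probability space, $N \ge 1$, and $P = \mu^{\otimes N}$ the product probability on $\Omega^N$. Let $A \subseteq \Omega^N$ be measurable with $P(A) > 0$ and let $\alpha > 0$. Then for all $t \ge 0$, $\int^* e^{t f(A,x)}\, dP(x) \le \frac{1}{P(A)^{\alpha}} \exp\Big(N \frac{t^2}{8}\big(1 + \tfrac{1}{\alpha}\big)\Big)$. Moreover, for every $k \ge \sqrt{\tfrac{N}{2}\log\tfrac{1}{P(A)}}$, $P^*(\{x : f(A,x) \ge k\}) \le \exp\Big(-\tfrac{2}{N}\Big(k - \sqrt{\tfrac{N}{2}\log\tfrac{1}{P(A)}}\Big)^2\Big)$. -/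
open MeasureTheory ENNReal

/-- The upper (outer) integral: infimum of `∫⁻ g` over measurable `g ≥ f`. -/
noncomputable def upperLintegral {α : Type*} [MeasurableSpace α] (μ : Measure α)
    (f : α → ℝ≥0∞) : ℝ≥0∞ :=
  ⨅ (g : α → ℝ≥0∞) (_ : Measurable g) (_ : ∀ x, f x ≤ g x), ∫⁻ x, g x ∂μ

/-- The product probability `μ^{⊗N}` on `Ω^N`. -/
noncomputable def piP {Ω : Type*} [MeasurableSpace Ω] (μ : Measure Ω) [SigmaFinite μ]
    (N : ℕ) : Measure (Fin N → Ω) :=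
  Measure.pi fun _ : Fin N => μ

/-- `f(A, x)`: the Hamming distance from `x` to the set `A`. -/
noncomputable def hamDistSet {N : ℕ} {Ω : Type*} (A : Set (Fin N → Ω))
    (x : Fin N → Ω) : ℝ :=
  ⨅ y : A, (Nat.card {i : Fin N // x i ≠ (y : Fin N → Ω) i} : ℝ)

/-- Hoeffding's lemma, as an upper bound on a lower Lebesgue integral. -/
theorem lintegral_exp_mul_le_of_mem_Icc {Ω : Type*} [MeasurableSpace Ω] (μ : Measure Ω)
    [IsProbabilityMeasure μ] {X : Ω → ℝ} (hX : Measurable X) {c d : ℝ}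
    (hXcd : ∀ᵐ ω ∂μ, X ω ∈ Set.Icc c d) (r : ℝ) :
    ∫⁻ ω, ENNReal.ofReal (Real.exp (r * X ω)) ∂μ ≤
      ENNReal.ofReal (Real.exp (r * (∫ ω, X ω ∂μ) + r ^ 2 * (d - c) ^ 2 / 8)) := by
  have h := ProbabilityTheory.hasSubgaussianMGF_of_mem_Icc hX.aemeasurable hXcd
  have hsplit : ∀ ω, Real.exp (r * X ω) =
      Real.exp (r * ∫ ω, X ω ∂μ) * Real.exp (r * (X ω - ∫ ω, X ω ∂μ)) := fun ω => by
    rw [← Real.exp_add]; ring_nf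
  have hint : Integrable (fun ω => Real.exp (r * X ω)) μ := by
    simp_rw [hsplit]
    exact (h.integrable_exp_mul r).const_mul _
  rw [← ofReal_integral_eq_lintegral_ofReal hint (ae_of_all _ fun ω => (Real.exp_pos _).le)]
  refine ENNReal.ofReal_le_ofReal ?_
  simp_rw [hsplit]
  rw [integral_const_mul, Real.exp_add]
  gcongr
  refine (h.mgf_le r).trans (le_of_eq ?_)
  congr 1
  simp only [NNReal.coe_pow, NNReal.coe_div, coe_nnnorm, Real.norm_eq_abs, NNReal.coe_ofNat,
    div_pow, sq_abs]
  ring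

/-- The one-dimensional inequality behind the induction on the number of coordinates. -/
theorem lintegral_min_inv_rpow_le {Ω : Type*} [MeasurableSpace Ω] (μ : Measure Ω)
    [IsProbabilityMeasure μ] {p : Ω → ℝ≥0∞} (hp : Measurable p) {b : ℝ≥0∞} (hb : b ≠ ∞)
    (hpb : ∀ᵐ ω ∂μ, p ω ≤ b) {α t : ℝ} (hα : 0 < α) (ht : 0 ≤ t) :
    ∫⁻ ω, min (p ω ^ α)⁻¹ (ENNReal.ofReal (Real.exp t) * (b ^ α)⁻¹) ∂μ ≤
      ((∫⁻ ω, p ω ∂μ) ^ α)⁻¹ * ENNReal.ofReal (Real.exp (t ^ 2 / 8 * (1 + 1 / α))) := by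
  rcases eq_or_ne b 0 with rfl | hb0
  · have h0 : ∫⁻ ω, p ω ∂μ = 0 := by
      rw [lintegral_eq_zero_iff hp]
      filter_upwards [hpb] with ω hω using le_antisymm hω bot_le
    rw [h0, ENNReal.zero_rpow_of_pos hα, ENNReal.inv_zero,
      ENNReal.top_mul (by simp [Real.exp_pos])]
    exact le_top
  lift b to NNReal using hb
  have hbpos : (0 : ℝ) < b := by
    have : b ≠ 0 := by simpa using hb0
    exact_mod_cast this.bot_lt
  set δ : ℝ := b * Real.exp (-(t / α)) with hδ
  have hδpos : 0 < δ := by positivity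
  set q : Ω → ℝ := fun ω => max (p ω).toReal δ
  have hqpos : ∀ ω, 0 < q ω := fun ω => lt_max_of_lt_right hδpos
  set X : Ω → ℝ := fun ω => Real.log (q ω)
  have hXm : Measurable X := (hp.ennreal_toReal.max measurable_const).log
  have hexp : ∀ ω, Real.exp (X ω) = q ω := fun ω => Real.exp_log (hqpos ω)
  have hδb : δ ≤ b := by
    rw [hδ]
    refine mul_le_of_le_one_right hbpos.le (Real.exp_le_one_iff.2 ?_)
    have : 0 ≤ t / α := by positivity
    linarith
  have hXcd : ∀ᵐ ω ∂μ, X ω ∈ Set.Icc (Real.log b - t / α) (Real.log b) := by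
    filter_upwards [hpb] with ω hω
    have hlogδ : Real.log δ = Real.log b - t / α := by
      rw [hδ, Real.log_mul hbpos.ne' (Real.exp_pos _).ne', Real.log_exp]; ring
    refine ⟨?_, ?_⟩
    · rw [← hlogδ]
      exact Real.log_le_log hδpos (le_max_right _ _)
    · refine Real.log_le_log (hqpos ω) (max_le ?_ hδb)
      exact ENNReal.toReal_le_coe_of_le_coe hω
  have hnum := lintegral_exp_mul_le_of_mem_Icc μ hXm hXcd (-α)
  have hden := lintegral_exp_mul_le_of_mem_Icc μ hXm hXcd 1
  have hmin : ∫⁻ ω, min (p ω ^ α)⁻¹ (ENNReal.ofReal (Real.exp t) * ((b : ℝ≥0∞) ^ α)⁻¹) ∂μ ≤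
      ∫⁻ ω, ENNReal.ofReal (Real.exp (-α * X ω)) ∂μ := by
    refine lintegral_mono_ae ?_
    filter_upwards [hpb] with ω hω
    have hpω : p ω ≠ ∞ := ne_top_of_le_ne_top ENNReal.coe_ne_top hω
    rcases le_total δ (p ω).toReal with hle | hle
    · refine (min_le_left _ _).trans (le_of_eq ?_)
      have hqe : q ω = (p ω).toReal := max_eq_left hle
      rw [mul_comm, Real.exp_mul, hexp, hqe, Real.rpow_neg ENNReal.toReal_nonneg,
        ENNReal.ofReal_inv_of_pos (Real.rpow_pos_of_pos (hδpos.trans_le hle) _),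
        ← ENNReal.ofReal_rpow_of_pos (hδpos.trans_le hle), ENNReal.ofReal_toReal hpω]
    · refine (min_le_right _ _).trans (le_of_eq ?_)
      have hqe : q ω = δ := max_eq_right hle
      have hδα : δ ^ (-α) = Real.exp t * ((b : ℝ) ^ α)⁻¹ := by
        rw [hδ, Real.mul_rpow hbpos.le (Real.exp_pos _).le, ← Real.exp_mul,
          Real.rpow_neg hbpos.le, mul_comm]
        congr 2
        field_simp
      rw [mul_comm (-α), Real.exp_mul, hexp, hqe, hδα, ENNReal.ofReal_mul (Real.exp_pos _).le,
        ENNReal.ofReal_inv_of_pos (Real.rpow_pos_of_pos hbpos _),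
        ← ENNReal.ofReal_rpow_of_pos hbpos, ENNReal.ofReal_coe_nnreal]
  have hp_le : ∫⁻ ω, p ω ∂μ ≤ ∫⁻ ω, ENNReal.ofReal (Real.exp (1 * X ω)) ∂μ := by
    refine lintegral_mono_ae ?_
    filter_upwards [hpb] with ω hω
    have hpω : p ω ≠ ∞ := ne_top_of_le_ne_top ENNReal.coe_ne_top hω
    rw [one_mul, hexp, ENNReal.le_ofReal_iff_toReal_le hpω (hqpos ω).le]
    exact le_max_left _ _
  set m : ℝ := ∫ ω, X ω ∂μ
  calc _ ≤ _ := hmin.trans hnum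
    _ = (ENNReal.ofReal (Real.exp (1 * m +
          1 ^ 2 * (Real.log b - (Real.log b - t / α)) ^ 2 / 8)) ^ α)⁻¹ *
        ENNReal.ofReal (Real.exp (t ^ 2 / 8 * (1 + 1 / α))) := by
      rw [ENNReal.ofReal_rpow_of_pos (Real.exp_pos _), ← Real.exp_mul,
        ← ENNReal.ofReal_inv_of_pos (Real.exp_pos _), ← Real.exp_neg,
        ← ENNReal.ofReal_mul (Real.exp_pos _).le, ← Real.exp_add]
      congr 2
      field_simp
      ring
    _ ≤ _ := by
      gcongr
      exact hp_le.trans hden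

theorem measurable_finCons {Ω : Type*} [MeasurableSpace Ω] {N : ℕ} :
    Measurable fun z : Ω × (Fin N → Ω) => (Fin.cons z.1 z.2 : Fin (N + 1) → Ω) := by
  refine measurable_pi_iff.2 fun i => ?_
  refine Fin.cases ?_ (fun j => ?_) i
  · simpa using measurable_fst
  · simpa [Function.comp_def] using (measurable_pi_apply j).comp (measurable_snd (α := Ω))

instance {Ω : Type*} [MeasurableSpace Ω] (μ : Measure Ω) [IsProbabilityMeasure μ] (N : ℕ) :
    IsProbabilityMeasure (piP μ N) := by
  unfold piP; infer_instance

theorem lintegral_piP_succ {Ω : Type*} [MeasurableSpace Ω] (μ : Measure Ω)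
    [IsProbabilityMeasure μ] {N : ℕ} {g : (Fin (N + 1) → Ω) → ℝ≥0∞} (hg : Measurable g) :
    ∫⁻ y, g y ∂(piP μ (N + 1)) =
      ∫⁻ ω, ∫⁻ x, g (Fin.cons ω x) ∂(piP μ N) ∂μ := by
  have h := (measurePreserving_piFinSuccAbove (fun _ : Fin (N + 1) => μ) 0).symm
  rw [piP, ← h.lintegral_comp hg, lintegral_prod _ (by
    exact (hg.comp h.measurable).aemeasurable)]
  simp [piP, MeasurableEquiv.piFinSuccAbove, Fin.insertNthEquiv]

theorem natCard_cons_ne_cons_self {Ω : Type*} {N : ℕ} (ω : Ω) (x y : Fin N → Ω) :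
    Nat.card {i : Fin (N + 1) // (Fin.cons ω x : Fin (N + 1) → Ω) i ≠
      (Fin.cons ω y : Fin (N + 1) → Ω) i} = Nat.card {i : Fin N // x i ≠ y i} := by
  classical
  rw [Nat.card_eq_fintype_card, Nat.card_eq_fintype_card, Fintype.card_subtype,
    Fintype.card_subtype, Fin.card_filter_univ_succ]
  simp

theorem natCard_cons_ne_cons_le {Ω : Type*} {N : ℕ} (ω ω' : Ω) (x y : Fin N → Ω) :
    Nat.card {i : Fin (N + 1) // (Fin.cons ω x : Fin (N + 1) → Ω) i ≠
      (Fin.cons ω' y : Fin (N + 1) → Ω) i} ≤ Nat.card {i : Fin N // x i ≠ y i} + 1 := by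
  classical
  rw [Nat.card_eq_fintype_card, Nat.card_eq_fintype_card, Fintype.card_subtype,
    Fintype.card_subtype, Fin.card_filter_univ_succ]
  simp only [Fin.cons_zero, Fin.cons_succ]
  split_ifs <;> simp

universe u

/-- A jointly measurable family of majorants of `x ↦ exp (t * f(A_s, x))`, where `A_s` is the
section at `s` of a measurable set `A`, with the exponential moment bound for every `s`. -/
theorem exists_measurable_majorant {Ω : Type u} [MeasurableSpace Ω] (μ : Measure Ω)
    [IsProbabilityMeasure μ] {α t : ℝ} (hα : 0 < α) (ht : 0 ≤ t) (N : ℕ) :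
    ∀ (S : Type u) [MeasurableSpace S] (A : Set (S × (Fin N → Ω))), MeasurableSet A →
      ∃ G : S × (Fin N → Ω) → ℝ≥0∞, Measurable G ∧
        (∀ s x, G (s, x) = ∞ ∨ ∃ y, (s, y) ∈ A ∧
          ENNReal.ofReal (Real.exp (t * Nat.card {i : Fin N // x i ≠ y i})) ≤ G (s, x)) ∧
        ∀ s, ∫⁻ x, G (s, x) ∂(piP μ N) ≤ (piP μ N {x | (s, x) ∈ A} ^ α)⁻¹ *
          ENNReal.ofReal (Real.exp (t ^ 2 / 8 * (1 + 1 / α))) ^ N := by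
  classical
  induction N with
  | zero =>
    intro S _ A hA
    refine ⟨fun z => if z ∈ A then 1 else ∞,
      Measurable.ite hA measurable_const measurable_const, fun s x => ?_, fun s => ?_⟩
    · by_cases h : (s, x) ∈ A
      · exact Or.inr ⟨x, h, by simp [h]⟩
      · exact Or.inl (by simp [h])
    · by_cases h : (s, (default : Fin 0 → Ω)) ∈ A
      · have hG : ∀ x : Fin 0 → Ω, (s, x) ∈ A := fun x => by
          rwa [Subsingleton.elim x default]
        simp [hG]
      · have hset : {x : Fin 0 → Ω | (s, x) ∈ A} = ∅ :=
          Set.eq_empty_of_forall_notMem fun x hx => h (by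
            rwa [Set.mem_ofPred_eq, Subsingleton.elim x default] at hx)
        simp [hset, ENNReal.zero_rpow_of_pos hα]
  | succ N ih =>
    intro S _ A hA
    set c : ℝ≥0∞ := ENNReal.ofReal (Real.exp (t ^ 2 / 8 * (1 + 1 / α)))
    have hcons : Measurable fun z : (S × Ω) × (Fin N → Ω) =>
        (z.1.1, (Fin.cons z.1.2 z.2 : Fin (N + 1) → Ω)) :=
      (measurable_fst.comp measurable_fst).prodMk
        (measurable_finCons.comp ((measurable_snd.comp measurable_fst).prodMk measurable_snd))
    have hcons' : Measurable fun z : (S × (Fin N → Ω)) × Ω =>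
        (z.1.1, (Fin.cons z.2 z.1.2 : Fin (N + 1) → Ω)) :=
      (measurable_fst.comp measurable_fst).prodMk
        (measurable_finCons.comp (measurable_snd.prodMk (measurable_snd.comp measurable_fst)))
    set A' : Set ((S × Ω) × (Fin N → Ω)) :=
      {z | (z.1.1, (Fin.cons z.1.2 z.2 : Fin (N + 1) → Ω)) ∈ A}
    set B : Set (S × (Fin N → Ω)) :=
      {z | 0 < μ {ω | (z.1, (Fin.cons ω z.2 : Fin (N + 1) → Ω)) ∈ A}}
    have hA'm : MeasurableSet A' := hcons hA
    have hBm : MeasurableSet B :=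
      measurableSet_lt measurable_const (measurable_measure_prodMk_left (ν := μ) (hcons' hA))
    obtain ⟨G', hG'm, hG', hG'int⟩ := ih (S × Ω) A' hA'm
    obtain ⟨H, hHm, hH, hHint⟩ := ih S B hBm
    have htail : Measurable fun z : S × (Fin (N + 1) → Ω) => Fin.tail z.2 :=
      measurable_pi_iff.2 fun i => (measurable_pi_apply i.succ).comp measurable_snd
    have hhead : Measurable fun z : S × (Fin (N + 1) → Ω) => z.2 0 :=
      (measurable_pi_apply 0).comp measurable_snd
    have hGm : Measurable fun z : S × (Fin (N + 1) → Ω) =>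
        min (G' ((z.1, z.2 0), Fin.tail z.2))
          (ENNReal.ofReal (Real.exp t) * H (z.1, Fin.tail z.2)) :=
      (hG'm.comp ((measurable_fst.prodMk hhead).prodMk htail)).min
        ((hHm.comp (measurable_fst.prodMk htail)).const_mul _)
    refine ⟨_, hGm, fun s y => ?_, fun s => ?_⟩
    · obtain ⟨ω, x, rfl⟩ : ∃ ω x, (Fin.cons ω x : Fin (N + 1) → Ω) = y :=
        ⟨y 0, Fin.tail y, Fin.cons_self_tail y⟩
      simp only [Fin.cons_zero, Fin.tail_cons]
      rcases min_choice (G' ((s, ω), x)) (ENNReal.ofReal (Real.exp t) * H (s, x)) with h | h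
      · rw [h]
        refine (hG' (s, ω) x).imp id ?_
        rintro ⟨y, hy, hle⟩
        refine ⟨Fin.cons ω y, hy, ?_⟩
        rwa [natCard_cons_ne_cons_self]
      · rw [h]
        rcases hH s x with hx | ⟨y, hy, hle⟩
        · left
          rw [hx, ENNReal.mul_top (by simp [Real.exp_pos])]
        · right
          obtain ⟨ω', hω'⟩ := nonempty_of_measure_ne_zero (ne_of_gt hy)
          refine ⟨Fin.cons ω' y, hω', ?_⟩
          refine le_trans ?_ (mul_le_mul_right hle _)
          rw [← ENNReal.ofReal_mul (Real.exp_pos _).le, ← Real.exp_add]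
          have hcard : (Nat.card {i : Fin (N + 1) // (Fin.cons ω x : Fin (N + 1) → Ω) i ≠
              (Fin.cons ω' y : Fin (N + 1) → Ω) i} : ℝ) ≤
              Nat.card {i : Fin N // x i ≠ y i} + 1 := by
            exact_mod_cast natCard_cons_ne_cons_le ω ω' x y
          refine ENNReal.ofReal_le_ofReal (Real.exp_le_exp.2 ?_)
          nlinarith [mul_le_mul_of_nonneg_left hcard ht]
    · set p : Ω → ℝ≥0∞ := fun ω => piP μ N {x | ((s, ω), x) ∈ A'}
      set b : ℝ≥0∞ := piP μ N {x | (s, x) ∈ B}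
      have hpm : Measurable p :=
        (measurable_measure_prodMk_left (ν := piP μ N) hA'm).comp measurable_prodMk_left
      have hsec : Measurable fun z : (Fin N → Ω) × Ω => ((s, z.2), z.1) :=
        (measurable_const.prodMk measurable_snd).prodMk measurable_fst
      have hpb : ∀ᵐ ω ∂μ, p ω ≤ b := by
        have hae : ∀ᵐ ω ∂μ, ∀ᵐ x ∂(piP μ N), ((s, ω), x) ∈ A' → (s, x) ∈ B := by
          refine (Measure.ae_ae_comm (μ := piP μ N) (ν := μ)
            (p := fun x ω => ((s, ω), x) ∈ A' → (s, x) ∈ B) ?_).1 (ae_of_all _ fun x => ?_)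
          · exact (hsec hA'm).imp (measurable_const.prodMk measurable_fst hBm)
          · by_cases hx : (s, x) ∈ B
            · exact ae_of_all _ fun ω _ => hx
            · have hzero : μ {ω | ((s, ω), x) ∈ A'} = 0 := le_bot_iff.1 (not_lt.1 hx)
              filter_upwards [measure_eq_zero_iff_ae_notMem.1 hzero] with ω hω h
              exact absurd h hω
        filter_upwards [hae] with ω hω using measure_mono_ae hω
      have hpint : ∫⁻ ω, p ω ∂μ = piP μ (N + 1) {y | (s, y) ∈ A} := by
        have hAs : MeasurableSet {y : Fin (N + 1) → Ω | (s, y) ∈ A} := measurable_prodMk_left hA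
        rw [← lintegral_indicator_one hAs,
          lintegral_piP_succ μ (measurable_one.indicator hAs)]
        refine lintegral_congr fun ω => ?_
        have hAω : MeasurableSet {x | ((s, ω), x) ∈ A'} := measurable_prodMk_left hA'm
        exact (lintegral_indicator_one hAω).symm
      rw [← hpint]
      refine (lintegral_piP_succ μ (hGm.comp (measurable_prodMk_left (x := s)))).le.trans ?_
      calc _ ≤ ∫⁻ ω, min (p ω ^ α)⁻¹ (ENNReal.ofReal (Real.exp t) * (b ^ α)⁻¹) * c ^ N ∂μ := by
            refine lintegral_mono fun ω => ?_
            rw [(mul_left_mono (a := c ^ N)).map_min]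
            simp only [Function.comp_apply, Fin.cons_zero, Fin.tail_cons]
            refine le_min ((lintegral_mono fun x => min_le_left _ _).trans (hG'int (s, ω)))
              ((lintegral_mono fun x => min_le_right _ _).trans ?_)
            rw [lintegral_const_mul _ (by fun_prop), mul_assoc]
            gcongr
            exact hHint s
        _ ≤ ((∫⁻ ω, p ω ∂μ) ^ α)⁻¹ * c * c ^ N := by
            rw [lintegral_mul_const _ (by fun_prop)]
            gcongr
            exact lintegral_min_inv_rpow_le μ hpm (measure_ne_top _ _) hpb hα ht
        _ = _ := by rw [pow_succ', mul_assoc]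

theorem upperLintegral_exp_hamDistSet_le {Ω : Type u} [MeasurableSpace Ω] (μ : Measure Ω)
    [IsProbabilityMeasure μ] (N : ℕ) {A : Set (Fin N → Ω)} (hA : MeasurableSet A)
    {α t : ℝ} (hα : 0 < α) (ht : 0 ≤ t) :
    upperLintegral (piP μ N) (fun x => ENNReal.ofReal (Real.exp (t * hamDistSet A x))) ≤
      (piP μ N A ^ α)⁻¹ *
        ENNReal.ofReal (Real.exp ((N : ℝ) * (t ^ 2 / 8) * (1 + 1 / α))) := by
  obtain ⟨G, hGm, hG, hGint⟩ := exists_measurable_majorant μ hα ht N PUnit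
    {z : PUnit × (Fin N → Ω) | z.2 ∈ A} (measurable_snd hA)
  refine (iInf₂_le (fun x => G (PUnit.unit, x)) (hGm.comp measurable_prodMk_left)).trans
    ((iInf_le _ fun x => ?_).trans ((hGint PUnit.unit).trans (le_of_eq ?_)))
  · rcases hG PUnit.unit x with h | ⟨y, hy, hle⟩
    · exact le_top.trans h.ge
    · refine le_trans (ENNReal.ofReal_le_ofReal (Real.exp_le_exp.2 ?_)) hle
      refine mul_le_mul_of_nonneg_left ?_ ht
      exact ciInf_le (f := fun y : A => (Nat.card {i // x i ≠ (y : Fin N → Ω) i} : ℝ))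
        ⟨0, by rintro _ ⟨z, rfl⟩; positivity⟩ ⟨y, hy⟩
  · rw [← ENNReal.ofReal_pow (Real.exp_pos _).le, ← Real.exp_nat_mul]
    simp only [Set.mem_ofPred_eq, Set.ofPred_mem_eq, mul_assoc]

theorem mul_measure_le_upperLintegral {β : Type*} [MeasurableSpace β] (P : Measure β)
    (f : β → ℝ≥0∞) (c : ℝ≥0∞) : c * P {x | c ≤ f x} ≤ upperLintegral P f := by
  refine le_iInf₂ fun g hg => le_iInf fun hfg => ?_
  refine le_trans ?_ (mul_meas_ge_le_lintegral hg c)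
  exact mul_le_mul_right (measure_mono fun x (hx : c ≤ f x) => hx.trans (hfg x)) _


/-- The Chernoff bound with the parameters `t = 4 (k - σ) / N` and `α = (k - σ) / σ`. -/
theorem measure_le_hamDistSet_le {Ω : Type u} [MeasurableSpace Ω] (μ : Measure Ω)
    [IsProbabilityMeasure μ] {N : ℕ} (hN : 1 ≤ N) {A : Set (Fin N → Ω)} (hA : MeasurableSet A)
    (hA0 : 0 < piP μ N A) {σ k : ℝ}
    (hσ : Real.sqrt ((N / 2) * Real.log (1 / (piP μ N A).toReal)) < σ) (hσk : σ < k) :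
    piP μ N {x | k ≤ hamDistSet A x} ≤
      ENNReal.ofReal (Real.exp (-(2 / N) * (k - σ) ^ 2)) := by
  have hNpos : (0 : ℝ) < N := by exact_mod_cast hN
  have hσpos : 0 < σ := (Real.sqrt_nonneg _).trans_lt hσ
  have hkσ : 0 < k - σ := sub_pos.2 hσk
  set t : ℝ := 4 * (k - σ) / N with ht
  set β : ℝ := (k - σ) / σ with hβ
  have htpos : 0 < t := by positivity
  have hβpos : 0 < β := by positivity
  have hApos : 0 < (piP μ N A).toReal := ENNReal.toReal_pos hA0.ne' (measure_ne_top _ _)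
  have hlog : Real.log (1 / (piP μ N A).toReal) ≤ 2 * σ ^ 2 / N := by
    have h := (Real.sqrt_lt' hσpos).1 hσ
    rw [le_div_iff₀ hNpos]
    linarith
  have hinv : (piP μ N A ^ β)⁻¹ ≤ ENNReal.ofReal (Real.exp (β * (2 * σ ^ 2 / N))) := by
    rw [← ENNReal.ofReal_toReal (measure_ne_top (piP μ N) A), ENNReal.ofReal_rpow_of_pos hApos,
      ← ENNReal.ofReal_inv_of_pos (Real.rpow_pos_of_pos hApos _)]
    refine ENNReal.ofReal_le_ofReal ?_
    rw [← Real.rpow_neg hApos.le, Real.rpow_def_of_pos hApos]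
    refine Real.exp_le_exp.2 ?_
    rw [one_div, Real.log_inv] at hlog
    nlinarith [mul_le_mul_of_nonneg_left hlog hβpos.le]
  have hmarkov := (mul_measure_le_upperLintegral (piP μ N)
    (fun x => ENNReal.ofReal (Real.exp (t * hamDistSet A x)))
    (ENNReal.ofReal (Real.exp (t * k)))).trans
      (upperLintegral_exp_hamDistSet_le μ N hA hβpos htpos.le)
  have hset : {x | ENNReal.ofReal (Real.exp (t * k)) ≤
      ENNReal.ofReal (Real.exp (t * hamDistSet A x))} = {x | k ≤ hamDistSet A x} := by
    ext x
    simp only [Set.mem_ofPred_eq]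
    rw [ENNReal.ofReal_le_ofReal_iff (Real.exp_pos _).le, Real.exp_le_exp,
      mul_le_mul_iff_right₀ htpos]
  rw [hset] at hmarkov
  have hc0 : ENNReal.ofReal (Real.exp (t * k)) ≠ 0 := by simp [Real.exp_pos]
  refine (ENNReal.mul_le_mul_iff_right hc0 ENNReal.ofReal_ne_top).1 (hmarkov.trans ?_)
  refine (mul_le_mul_left hinv _).trans (le_of_eq ?_)
  rw [← ENNReal.ofReal_mul (Real.exp_pos _).le, ← ENNReal.ofReal_mul (Real.exp_pos _).le,
    ← Real.exp_add, ← Real.exp_add]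
  congr 2
  rw [ht, hβ]
  field_simp
  ring

/-- Corollary 2.2.3 of Talagrand: for every `α > 0` and `t ≥ 0`,
`∫* e^{t f(A,x)} dP ≤ P(A)^{-α} exp(N (t²/8)(1 + 1/α))`; moreover, for every
`k ≥ √((N/2) log(1/P(A)))`,
`P*(f(A,·) ≥ k) ≤ exp(-(2/N)(k - √((N/2) log(1/P(A))))²)`. -/
theorem talagrand_stmt2 {Ω : Type*} [MeasurableSpace Ω] (μ : Measure Ω)
    [IsProbabilityMeasure μ] (N : ℕ) (hN : 1 ≤ N)
    (A : Set (Fin N → Ω)) (hA : MeasurableSet A) (hA0 : 0 < piP μ N A)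
    (α : ℝ) (hα : 0 < α) :
    (∀ t : ℝ, 0 ≤ t →
      upperLintegral (piP μ N) (fun x => ENNReal.ofReal (Real.exp (t * hamDistSet A x))) ≤
        (piP μ N A ^ α)⁻¹ *
          ENNReal.ofReal (Real.exp ((N : ℝ) * (t ^ 2 / 8) * (1 + 1 / α)))) ∧
    ∀ k : ℝ, Real.sqrt ((N / 2) * Real.log (1 / (piP μ N A).toReal)) ≤ k →
      piP μ N {x | k ≤ hamDistSet A x} ≤
        ENNReal.ofReal (Real.exp (-(2 / N) *
          (k - Real.sqrt ((N / 2) * Real.log (1 / (piP μ N A).toReal))) ^ 2)) := by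
  refine ⟨fun t ht => upperLintegral_exp_hamDistSet_le μ N hA hα ht, fun k hk => ?_⟩
  set s : ℝ := Real.sqrt ((N / 2) * Real.log (1 / (piP μ N A).toReal))
  rcases hk.eq_or_lt with rfl | hlt
  · simpa using prob_le_one
  · have hcont : Continuous fun σ : ℝ =>
        ENNReal.ofReal (Real.exp (-(2 / N) * (k - σ) ^ 2)) :=
      ENNReal.continuous_ofReal.comp (by fun_prop)
    refine ge_of_tendsto (hcont.continuousWithinAt (s := Set.Ioi s) (x := s)) ?_
    filter_upwards [Ioo_mem_nhdsGT hlt] with σ hσ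
    exact measure_le_hamDistSet_le μ hN hA hA0 hσ.1 hσ.2
end

section
/- Let $(\Omega,\Sigma,\mu)$ be a probability space, $N \ge 1$, $P = \mu^{\otimes N}$, and let $h : \Omega \times \Omega \to [0,\infty)$ be measurable with $h(\omega,\omega) = 0$ for all $\omega$ and $\|h\|_\infty = \sup_{x,y} h(x,y) < \infty$. Set $\|h\|_2 = \big(\iint_{\Omega^2} h(\omega,\omega')^2\, d\mu(\omega) d\mu(\omega')\big)^{1/2}$. Then for every measurable $A \subseteq \Omega^N$ with $P(A) > 0$ and every $u > 0$: $P^*(\{x : f_h(A,x) \ge u\}) \le \frac{1}{P(A)} \exp\Big(-\min\Big(\frac{u^2}{8 N \|h\|_2^2}, \frac{u}{2\|h\|_\infty}\Big)\Big)$. -/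
open MeasureTheory ENNReal

/-- `f_h(A,x) = inf { ∑_{i ≤ N} h(x_i, y_i) : y ∈ A }`. -/
noncomputable def fPenalty {N : ℕ} {Ω : Type*} (h : Ω → Ω → ℝ) (A : Set (Fin N → Ω))
    (x : Fin N → Ω) : ℝ :=
  ⨅ y : A, ∑ i, h (x i) ((y : Fin N → Ω) i)

universe u

theorem measurable_essInf_prod {α β : Type*} [MeasurableSpace α] [MeasurableSpace β]
    (μ : Measure β) [SFinite μ] (G : α × β → ℝ≥0∞) (hG : Measurable G) :
    Measurable fun a => essInf (fun b => G (a, b)) μ := by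
  refine measurable_of_Ici fun c => ?_
  have key : (fun a => essInf (fun b => G (a, b)) μ) ⁻¹' Set.Ici c
      = {a | μ (Prod.mk a ⁻¹' {p | G p < c}) = 0} := by
    ext a
    simp only [Set.mem_preimage, Set.mem_Ici, Set.mem_ofPred_eq]
    constructor
    · intro hc
      have hae : ∀ᵐ b ∂μ, ¬ G (a, b) < c := by
        filter_upwards [ae_essInf_le (μ := μ) (f := fun b => G (a, b))] with b hb
        exact not_lt.2 (hc.trans hb)
      simpa [ae_iff] using hae
    · intro hc
      have hae : ∀ᵐ b ∂μ, c ≤ G (a, b) := by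
        simpa [ae_iff] using hc
      exact le_essInf_of_ae_le c hae
  rw [key]
  exact measurable_measure_prodMk_left (measurableSet_lt hG measurable_const)
    (measurableSet_singleton 0)

theorem cosh_le_one_add_sq {s : ℝ} (h0 : 0 ≤ s) (h1 : s ≤ 1) : Real.cosh s ≤ 1 + s ^ 2 := by
  have hs : s ^ 2 ≤ 1 := by nlinarith
  have h2 : |s ^ 2 / 2| ≤ 1 := by rw [abs_of_nonneg (by positivity)]; linarith
  have h3 := (abs_le.1 (Real.abs_exp_sub_one_le h2)).2
  rw [abs_of_nonneg (by positivity)] at h3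
  have h4 := Real.cosh_le_exp_half_sq s
  linarith

theorem add_le_of_mul_le_one_of_one_le {a b s : ℝ} (ha : 1 ≤ a) (hab : a * b ≤ 1)
    (hs : s ≤ 1) (has : a ≤ Real.exp s) : a + b ≤ 2 + 2 * s ^ 2 := by
  have ha0 : 0 < a := by linarith
  have hlog0 : 0 ≤ Real.log a := Real.log_nonneg ha
  have hlog : Real.log a ≤ s := (Real.log_le_iff_le_exp ha0).2 has
  have hb : b ≤ a⁻¹ := by rw [← one_div, le_div_iff₀ ha0]; linarith
  have hc := cosh_le_one_add_sq hlog0 (hlog.trans hs)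
  rw [Real.cosh_eq, Real.exp_neg, Real.exp_log ha0] at hc
  have : Real.log a ^ 2 ≤ s ^ 2 := by gcongr
  linarith

theorem add_le_of_mul_le_one {a b s r : ℝ} (hab : a * b ≤ 1)
    (hs : s ≤ 1) (hr : r ≤ 1) (has : a ≤ Real.exp s) (hbr : b ≤ Real.exp r) :
    a + b ≤ 2 + 2 * s ^ 2 + 2 * r ^ 2 := by
  have hs2 := sq_nonneg s
  have hr2 := sq_nonneg r
  rcases le_total 1 a with h1 | h1
  · linarith [add_le_of_mul_le_one_of_one_le h1 hab hs has]
  rcases le_total 1 b with h2 | h2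
  · linarith [add_le_of_mul_le_one_of_one_le h2 ((mul_comm b a).trans_le hab) hr hbr]
  linarith

theorem ennreal_add_le_of_mul_le_one {a b : ℝ≥0∞} {s r : ℝ} (hab : a * b ≤ 1)
    (hs : s ≤ 1) (hr : r ≤ 1) (has : a ≤ ENNReal.ofReal (Real.exp s))
    (hbr : b ≤ ENNReal.ofReal (Real.exp r)) :
    a + b ≤ 2 + 2 * ENNReal.ofReal (s ^ 2) + 2 * ENNReal.ofReal (r ^ 2) := by
  lift a to NNReal using ne_top_of_le_ne_top ofReal_ne_top has
  lift b to NNReal using ne_top_of_le_ne_top ofReal_ne_top hbr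
  have key : (a : ℝ) + b ≤ 2 + 2 * s ^ 2 + 2 * r ^ 2 := by
    refine add_le_of_mul_le_one (by exact_mod_cast hab) hs hr ?_ ?_
    · simpa using (ENNReal.le_ofReal_iff_toReal_le coe_ne_top (Real.exp_nonneg s)).1 has
    · simpa using (ENNReal.le_ofReal_iff_toReal_le coe_ne_top (Real.exp_nonneg r)).1 hbr
  have := ENNReal.ofReal_le_ofReal key
  rw [ENNReal.ofReal_add (by positivity) (by positivity),
    ENNReal.ofReal_add (by positivity) (by positivity),
    ENNReal.ofReal_add (by positivity) (by positivity),
    ENNReal.ofReal_mul (by positivity), ENNReal.ofReal_mul (by positivity)] at this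
  simpa using this

/-- The one-coordinate inequality behind the induction on the dimension. -/
theorem lintegral_mul_lintegral_le {Ω : Type*} [MeasurableSpace Ω] (μ : Measure Ω)
    [IsProbabilityMeasure μ] (h : Ω → Ω → ℝ) (hmeas : Measurable fun p : Ω × Ω => h p.1 p.2)
    (hle : ∀ x y, h x y ≤ 1) (G g : Ω → ℝ≥0∞) (hG : Measurable G) (hg : Measurable g)
    (hdiag : ∀ ω, G ω * g ω ≤ 1)
    (hoff : ∀ ω, ∀ᵐ ω' ∂μ, G ω * g ω' ≤ ENNReal.ofReal (Real.exp (h ω ω'))) :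
    (∫⁻ ω, G ω ∂μ) * ∫⁻ ω, g ω ∂μ
      ≤ 1 + 2 * ∫⁻ p : Ω × Ω, ENNReal.ofReal (h p.1 p.2 ^ 2) ∂(μ.prod μ) := by
  have hm : Measurable fun p : Ω × Ω => G p.1 * g p.2 :=
    (hG.comp measurable_fst).mul (hg.comp measurable_snd)
  have hk : Measurable fun p : Ω × Ω => ENNReal.ofReal (h p.1 p.2 ^ 2) :=
    (hmeas.pow_const 2).ennreal_ofReal
  have hae : ∀ᵐ p ∂(μ.prod μ), G p.1 * g p.2 ≤ ENNReal.ofReal (Real.exp (h p.1 p.2)) :=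
    (Measure.ae_prod_iff_ae_ae (measurableSet_le hm hmeas.exp.ennreal_ofReal)).2
      (Filter.Eventually.of_forall hoff)
  have hswap := (Measure.measurePreserving_swap (μ := μ) (ν := μ))
  have hae' : ∀ᵐ p ∂(μ.prod μ), G p.2 * g p.1 ≤ ENNReal.ofReal (Real.exp (h p.2 p.1)) :=
    hswap.quasiMeasurePreserving.ae hae
  have hprod : ∫⁻ p, G p.1 * g p.2 ∂(μ.prod μ) = (∫⁻ ω, G ω ∂μ) * ∫⁻ ω, g ω ∂μ :=
    lintegral_prod_mul hG.aemeasurable hg.aemeasurable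
  have hprod' : ∫⁻ p, G p.2 * g p.1 ∂(μ.prod μ) = (∫⁻ ω, G ω ∂μ) * ∫⁻ ω, g ω ∂μ := by
    rw [← hprod]; exact hswap.lintegral_comp hm
  have hk' : ∫⁻ p : Ω × Ω, ENNReal.ofReal (h p.2 p.1 ^ 2) ∂(μ.prod μ)
      = ∫⁻ p : Ω × Ω, ENNReal.ofReal (h p.1 p.2 ^ 2) ∂(μ.prod μ) :=
    hswap.lintegral_comp hk
  have hsum : ∫⁻ p, (G p.1 * g p.2 + G p.2 * g p.1) ∂(μ.prod μ)
      ≤ ∫⁻ p : Ω × Ω, (2 + 2 * ENNReal.ofReal (h p.1 p.2 ^ 2)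
        + 2 * ENNReal.ofReal (h p.2 p.1 ^ 2)) ∂(μ.prod μ) := by
    refine lintegral_mono_ae ?_
    filter_upwards [hae, hae'] with p hp hp'
    refine ennreal_add_le_of_mul_le_one ?_ (hle _ _) (hle _ _) hp hp'
    calc G p.1 * g p.2 * (G p.2 * g p.1) = (G p.1 * g p.1) * (G p.2 * g p.2) := by ring
      _ ≤ 1 * 1 := mul_le_mul' (hdiag _) (hdiag _)
      _ = 1 := one_mul 1
  rw [lintegral_add_left hm, hprod, hprod',
    lintegral_add_left (f := fun p : Ω × Ω => 2 + 2 * ENNReal.ofReal (h p.1 p.2 ^ 2))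
      ((hk.const_mul 2).const_add 2),
    lintegral_add_left measurable_const, lintegral_const_mul _ hk,
    lintegral_const_mul (f := fun p : Ω × Ω => ENNReal.ofReal (h p.2 p.1 ^ 2)) _
      (hk.comp measurable_swap), hk'] at hsum
  simp only [lintegral_const, measure_univ, mul_one] at hsum
  refine (ENNReal.mul_le_mul_iff_right (two_ne_zero (α := ℝ≥0∞)) ofNat_ne_top).1 ?_
  calc _ = _ := two_mul _
    _ ≤ _ := hsum
    _ = _ := by ring

/-- A jointly measurable majorant of `exp f_h(A_t, x)` for a measurable family `A_t` of subsets
of `Ω^N`, with controlled integral for every parameter `t`. -/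
theorem exists_measurable_majorant_s6 {Ω : Type u} [MeasurableSpace Ω] (μ : Measure Ω)
    [IsProbabilityMeasure μ] (h : Ω → Ω → ℝ) (hmeas : Measurable fun p : Ω × Ω => h p.1 p.2)
    (hdiag : ∀ ω, h ω ω = 0) (hle : ∀ x y, h x y ≤ 1) (C : ℝ≥0∞) (hC : C ≠ ⊤)
    (hhC : 1 + 2 * ∫⁻ p : Ω × Ω, ENNReal.ofReal (h p.1 p.2 ^ 2) ∂(μ.prod μ) ≤ C) (N : ℕ) :
    ∀ (T : Type u) [MeasurableSpace T] (A : Set (T × (Fin N → Ω))), MeasurableSet A →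
      ∃ F : T × (Fin N → Ω) → ℝ≥0∞, Measurable F ∧
        (∀ t x, ⨅ y ∈ {y | (t, y) ∈ A}, ∏ i, ENNReal.ofReal (Real.exp (h (x i) (y i)))
          ≤ F (t, x)) ∧
        ∀ t, (∫⁻ x, F (t, x) ∂(Measure.pi fun _ : Fin N => μ))
          * (Measure.pi fun _ : Fin N => μ) {y | (t, y) ∈ A} ≤ C ^ N := by
  induction N with
  | zero =>
    intro T _ A hA
    classical
    refine ⟨A.piecewise (fun _ => 1) (fun _ => ⊤),
      Measurable.piecewise hA measurable_const measurable_const, fun t x => ?_, fun t => ?_⟩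
    · by_cases hx : (t, x) ∈ A
      · simp only [Set.piecewise, hx, if_true]
        exact (iInf₂_le x hx).trans (by simp)
      · simp [Set.piecewise, hx]
    · by_cases he : ∃ y, (t, y) ∈ A
      · obtain ⟨y, hy⟩ := he
        have hall : ∀ x, (t, x) ∈ A := fun x => by rwa [Subsingleton.elim x y]
        simp [Set.piecewise, hall]
      · push Not at he
        simp [he]
  | succ N ih =>
    intro T _ A hA
    let e : (Fin (N + 1) → Ω) ≃ᵐ Ω × (Fin N → Ω) :=
      MeasurableEquiv.piFinSuccAbove (fun _ => Ω) 0
    have hmp : MeasurePreserving e.symm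
        (μ.prod (Measure.pi fun _ : Fin N => μ)) (Measure.pi fun _ : Fin (N + 1) => μ) :=
      (measurePreserving_piFinSuccAbove (fun _ : Fin (N + 1) => μ) 0).symm
    have he0 : ∀ ω z, e.symm (ω, z) 0 = ω := fun ω z => rfl
    have heS : ∀ ω z (i : Fin N), e.symm (ω, z) i.succ = z i := fun ω z i => rfl
    let A' : Set ((T × Ω) × (Fin N → Ω)) := {p | (p.1.1, e.symm (p.1.2, p.2)) ∈ A}
    have hA' : MeasurableSet A' := by
      have : Measurable fun p : (T × Ω) × (Fin N → Ω) => (p.1.1, e.symm (p.1.2, p.2)) := by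
        fun_prop
      exact this hA
    obtain ⟨F', hF'm, hF'le, hF'int⟩ := ih (T × Ω) A' hA'
    let Q : T × Ω × (Fin N → Ω) → Ω → ℝ≥0∞ := fun p ω' =>
      F' ((p.1, ω'), p.2.2) * ENNReal.ofReal (Real.exp (h p.2.1 ω'))
    have hQm : Measurable fun q : (T × Ω × (Fin N → Ω)) × Ω => Q q.1 q.2 := by
      refine Measurable.mul (hF'm.comp (by fun_prop)) (Measurable.ennreal_ofReal
        (Real.measurable_exp.comp (hmeas.comp
          (g := fun p : Ω × Ω => h p.1 p.2)
          (f := fun q : (T × Ω × (Fin N → Ω)) × Ω => (q.1.2.1, q.2)) (by fun_prop))))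
    let K : T × Ω × (Fin N → Ω) → ℝ≥0∞ := fun p =>
      min (F' ((p.1, p.2.1), p.2.2)) (essInf (Q p) μ)
    have hKm : Measurable K :=
      (hF'm.comp (by fun_prop)).min (measurable_essInf_prod μ (fun q => Q q.1 q.2) hQm)
    refine ⟨fun p => K (p.1, e p.2), hKm.comp (by fun_prop), fun t x => ?_, fun t => ?_⟩
    · obtain ⟨⟨ω, z⟩, rfl⟩ := e.symm.surjective x
      have step : ∀ ω', (⨅ y ∈ {y | (t, y) ∈ A},
          ∏ i, ENNReal.ofReal (Real.exp (h (e.symm (ω, z) i) (y i))))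
            ≤ F' ((t, ω'), z) * ENNReal.ofReal (Real.exp (h ω ω')) := by
        intro ω'
        refine le_trans ?_ (mul_le_mul_left (hF'le (t, ω') z) _)
        rw [ENNReal.iInf_mul_of_ne (by simp [Real.exp_pos]) ofReal_ne_top]
        refine le_iInf fun y => ?_
        rw [ENNReal.iInf_mul_of_ne (by simp [Real.exp_pos]) ofReal_ne_top]
        refine le_iInf fun hy => ?_
        refine (iInf₂_le (e.symm (ω', y)) hy).trans (le_of_eq ?_)
        rw [Fin.prod_univ_succ, mul_comm]
        simp only [he0, heS]
      simp only [MeasurableEquiv.apply_symm_apply]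
      refine le_min ?_ ?_
      · simpa [hdiag] using step ω
      · exact le_essInf_of_ae_le _ (Filter.Eventually.of_forall step)
    · let ν : Measure (Fin N → Ω) := Measure.pi fun _ : Fin N => μ
      let G : Ω → ℝ≥0∞ := fun ω => ∫⁻ z, K (t, ω, z) ∂ν
      let g : Ω → ℝ≥0∞ := fun ω => ν {y | ((t, ω), y) ∈ A'}
      have hGm : Measurable G :=
        Measurable.lintegral_prod_right' (f := fun p : Ω × (Fin N → Ω) => K (t, p))
          (hKm.comp (by fun_prop))
      have hSm : MeasurableSet {p : Ω × (Fin N → Ω) | ((t, p.1), p.2) ∈ A'} := by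
        have : Measurable fun p : Ω × (Fin N → Ω) => ((t, p.1), p.2) := by fun_prop
        exact this hA'
      have hgm : Measurable g := measurable_measure_prodMk_left hSm
      have hint : ∫⁻ x, K (t, e x) ∂(Measure.pi fun _ : Fin (N + 1) => μ) = ∫⁻ ω, G ω ∂μ := by
        rw [← hmp.lintegral_comp (f := fun x => K (t, e x)) (hKm.comp (by fun_prop))]
        simp only [MeasurableEquiv.apply_symm_apply]
        exact lintegral_prod _ (hKm.comp (by fun_prop)).aemeasurable
      have hmass : (Measure.pi fun _ : Fin (N + 1) => μ) {y | (t, y) ∈ A} = ∫⁻ ω, g ω ∂μ := by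
        have hAt : MeasurableSet {y | (t, y) ∈ A} := measurable_prodMk_left hA
        rw [← hmp.measure_preimage hAt.nullMeasurableSet]
        exact Measure.prod_apply hSm
      have hC1 : 1 ≤ C := le_self_add.trans hhC
      have hD0 : C ^ N ≠ 0 := pow_ne_zero _ (zero_lt_one.trans_le hC1).ne'
      have hDt : C ^ N ≠ ⊤ := ENNReal.pow_ne_top hC
      have hdg : ∀ ω, (G ω / C ^ N) * g ω ≤ 1 := by
        intro ω
        rw [← ENNReal.mul_div_right_comm]
        refine ENNReal.div_le_of_le_mul ?_
        rw [one_mul]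
        exact (mul_le_mul_left (lintegral_mono fun z => min_le_left _ _) _).trans
          (hF'int (t, ω))
      have hoff : ∀ ω, ∀ᵐ ω' ∂μ,
          (G ω / C ^ N) * g ω' ≤ ENNReal.ofReal (Real.exp (h ω ω')) := by
        intro ω
        have hae : ∀ᵐ ω' ∂μ, ∀ᵐ z ∂ν, K (t, ω, z) ≤ Q (t, ω, z) ω' := by
          have hms : MeasurableSet {p : (Fin N → Ω) × Ω | K (t, ω, p.1) ≤ Q (t, ω, p.1) p.2} :=
            measurableSet_le (hKm.comp (by fun_prop)) (hQm.comp
              (f := fun p : (Fin N → Ω) × Ω => ((t, ω, p.1), p.2)) (by fun_prop))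
          refine (Measure.ae_ae_comm hms).1 (Filter.Eventually.of_forall fun z => ?_)
          filter_upwards [ae_essInf_le (μ := μ) (f := Q (t, ω, z))] with ω' hω'
          exact (min_le_right _ _).trans hω'
        filter_upwards [hae] with ω' hω'
        have h1 : G ω ≤ (∫⁻ z, F' ((t, ω'), z) ∂ν) * ENNReal.ofReal (Real.exp (h ω ω')) := by
          rw [← lintegral_mul_const (f := fun z => F' ((t, ω'), z)) _ (by fun_prop)]
          exact lintegral_mono_ae hω'
        rw [← ENNReal.mul_div_right_comm]
        refine ENNReal.div_le_of_le_mul ?_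
        calc G ω * g ω' ≤ _ := mul_le_mul_left h1 (g ω')
          _ = ENNReal.ofReal (Real.exp (h ω ω')) * ((∫⁻ z, F' ((t, ω'), z) ∂ν) * g ω') := by ring
          _ ≤ _ := mul_le_mul_right (hF'int (t, ω')) _
      have hone := lintegral_mul_lintegral_le μ h hmeas hle (fun ω => G ω / C ^ N) g
        (hGm.div_const _) hgm hdg hoff
      rw [hint, hmass]
      simp only [div_eq_mul_inv] at hone
      rw [lintegral_mul_const _ hGm, ← div_eq_mul_inv, ← ENNReal.mul_div_right_comm] at hone
      rw [pow_succ', ← ENNReal.div_le_iff hD0 hDt]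
      exact hone.trans hhC

theorem piP_fPenalty_le {Ω : Type u} [MeasurableSpace Ω] (μ : Measure Ω)
    [IsProbabilityMeasure μ] (N : ℕ)
    (h : Ω → Ω → ℝ) (hmeas : Measurable fun p : Ω × Ω => h p.1 p.2)
    (hnn : ∀ x y, 0 ≤ h x y) (hdiag : ∀ ω, h ω ω = 0)
    (A : Set (Fin N → Ω)) (hA : MeasurableSet A) (hA0 : 0 < piP μ N A)
    (u t : ℝ) (ht : 0 ≤ t) (hth : ∀ x y, t * h x y ≤ 1) (hI : Integrable
      (fun p : Ω × Ω => (h p.1 p.2) ^ 2) (μ.prod μ)) :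
    piP μ N {x | u ≤ fPenalty h A x} ≤
      (piP μ N A)⁻¹ * ENNReal.ofReal (Real.exp
        (-(t * u - 2 * N * t ^ 2 * ∫ p : Ω × Ω, (h p.1 p.2) ^ 2 ∂(μ.prod μ)))) := by
  set I := ∫ p : Ω × Ω, (h p.1 p.2) ^ 2 ∂(μ.prod μ) with hIdef
  have hI0 : 0 ≤ I := integral_nonneg fun p => sq_nonneg _
  let C : ℝ≥0∞ := ENNReal.ofReal (Real.exp (2 * t ^ 2 * I))
  have hC : 1 + 2 * ∫⁻ p : Ω × Ω, ENNReal.ofReal ((t * h p.1 p.2) ^ 2) ∂(μ.prod μ) ≤ C := by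
    have h1 : ∫⁻ p : Ω × Ω, ENNReal.ofReal ((t * h p.1 p.2) ^ 2) ∂(μ.prod μ)
        = ENNReal.ofReal (t ^ 2 * I) := by
      rw [hIdef, ← integral_const_mul,
        ofReal_integral_eq_lintegral_ofReal (hI.const_mul _)
          (Filter.Eventually.of_forall fun p => by positivity)]
      simp only [mul_pow]
    have h2 : 1 + 2 * ENNReal.ofReal (t ^ 2 * I) = ENNReal.ofReal (1 + 2 * (t ^ 2 * I)) := by
      rw [ENNReal.ofReal_add (by positivity) (by positivity),
        ENNReal.ofReal_mul zero_le_two, ENNReal.ofReal_one, ENNReal.ofReal_ofNat]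
    rw [h1, h2]
    refine ENNReal.ofReal_le_ofReal ?_
    have := Real.add_one_le_exp (2 * t ^ 2 * I)
    linarith
  obtain ⟨F, hFm, hFle, hFint⟩ := exists_measurable_majorant_s6 μ (fun x y => t * h x y)
    (hmeas.const_mul t) (fun ω => by simp [hdiag]) hth C ofReal_ne_top hC N PUnit
    {p | p.2 ∈ A} (measurable_snd hA)
  have hPA : piP μ N A ≠ ⊤ := by unfold piP; exact measure_ne_top _ _
  have hsub : {x | u ≤ fPenalty h A x}
      ⊆ {x | ENNReal.ofReal (Real.exp (t * u)) ≤ F (PUnit.unit, x)} := by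
    intro x hx
    refine le_trans (le_iInf₂ fun y hy => ?_) (hFle PUnit.unit x)
    rw [← ENNReal.ofReal_prod_of_nonneg fun i _ => (Real.exp_pos _).le, ← Real.exp_sum,
      ← Finset.mul_sum]
    have hb : fPenalty h A x ≤ ∑ i, h (x i) (y i) :=
      ciInf_le (f := fun y : A => ∑ i, h (x i) ((y : Fin N → Ω) i))
        ⟨0, by rintro _ ⟨y, rfl⟩; exact Finset.sum_nonneg fun i _ => hnn _ _⟩ ⟨y, hy⟩
    have := hx.out.trans hb
    gcongr
  have hmarkov : ENNReal.ofReal (Real.exp (t * u)) * piP μ N {x | u ≤ fPenalty h A x}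
      ≤ ∫⁻ x, F (PUnit.unit, x) ∂(piP μ N) :=
    (mul_le_mul_right (measure_mono hsub) _).trans
      (mul_meas_ge_le_lintegral (by fun_prop) _)
  have hbound : ENNReal.ofReal (Real.exp (t * u)) * piP μ N {x | u ≤ fPenalty h A x}
      ≤ C ^ N / piP μ N A := by
    refine hmarkov.trans ?_
    rw [ENNReal.le_div_iff_mul_le (Or.inl hA0.ne') (Or.inl hPA)]
    exact hFint PUnit.unit
  have hCN : C ^ N = ENNReal.ofReal (Real.exp (2 * N * t ^ 2 * I)) := by
    rw [← ENNReal.ofReal_pow (Real.exp_pos _).le, ← Real.exp_nat_mul]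
    congr 2; ring
  rw [mul_comm, ← ENNReal.le_div_iff_mul_le (by simp [Real.exp_pos]) (by simp)] at hbound
  refine hbound.trans (le_of_eq ?_)
  rw [hCN, neg_sub, Real.exp_sub, ENNReal.ofReal_div_of_pos (Real.exp_pos _)]
  simp only [div_eq_mul_inv]
  ring

/-- Corollary 2.4.5 of Talagrand: if `‖h‖_∞ = sup h < ∞`, then with
`‖h‖₂² = ∬ h² dμ dμ`, for every measurable `A` with `P(A) > 0` and every `u > 0`,
`P*(f_h(A,·) ≥ u) ≤ (1/P(A)) exp(-min(u²/(8N‖h‖₂²), u/(2‖h‖_∞)))`. -/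
theorem talagrand_stmt6 {Ω : Type*} [MeasurableSpace Ω] (μ : Measure Ω)
    [IsProbabilityMeasure μ] (N : ℕ) (hN : 1 ≤ N)
    (h : Ω → Ω → ℝ) (hmeas : Measurable fun p : Ω × Ω => h p.1 p.2)
    (hnn : ∀ x y, 0 ≤ h x y) (hdiag : ∀ ω, h ω ω = 0)
    (hbdd : BddAbove (Set.range fun p : Ω × Ω => h p.1 p.2))
    (A : Set (Fin N → Ω)) (hA : MeasurableSet A) (hA0 : 0 < piP μ N A)
    (u : ℝ) (hu : 0 < u) :
    piP μ N {x | u ≤ fPenalty h A x} ≤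
      (piP μ N A)⁻¹ *
        ENNReal.ofReal (Real.exp
          (-(min (u ^ 2 / (8 * N * ∫ p : Ω × Ω, (h p.1 p.2) ^ 2 ∂(μ.prod μ)))
            (u / (2 * ⨆ p : Ω × Ω, h p.1 p.2))))) := by
  by_cases htriv : min (u ^ 2 / (8 * N * ∫ p : Ω × Ω, (h p.1 p.2) ^ 2 ∂(μ.prod μ)))
      (u / (2 * ⨆ p : Ω × Ω, h p.1 p.2)) ≤ 0
  · have : IsProbabilityMeasure (piP μ N) := by unfold piP; infer_instance
    refine prob_le_one.trans ?_
    rw [← one_mul (1 : ℝ≥0∞)]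
    refine mul_le_mul' (ENNReal.one_le_inv.2 prob_le_one) ?_
    rw [ENNReal.one_le_ofReal, Real.one_le_exp_iff]
    linarith
  set S := ⨆ p : Ω × Ω, h p.1 p.2 with hS
  set I := ∫ p : Ω × Ω, (h p.1 p.2) ^ 2 ∂(μ.prod μ) with hIdef
  obtain ⟨hmin1, hmin2⟩ := lt_min_iff.1 (not_le.1 htriv)
  have hI0 : 0 ≤ I := integral_nonneg fun p => sq_nonneg _
  have hIpos : 0 < I := hI0.lt_of_ne' fun h0 => by simp [h0] at hmin1
  have hSpos : 0 < S := (Real.iSup_nonneg fun p : Ω × Ω => hnn p.1 p.2).lt_of_ne' fun h0 => by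
    rw [← hS] at h0
    simp [h0] at hmin2
  have hNpos : (0 : ℝ) < N := by exact_mod_cast hN
  have hle : ∀ x y, h x y ≤ S := fun x y => le_ciSup hbdd (x, y)
  have hint : Integrable (fun p : Ω × Ω => (h p.1 p.2) ^ 2) (μ.prod μ) := by
    refine Integrable.of_bound (hmeas.pow_const 2).aestronglyMeasurable (S ^ 2)
      (Filter.Eventually.of_forall fun p => ?_)
    rw [Real.norm_of_nonneg (sq_nonneg _)]
    exact pow_le_pow_left₀ (hnn _ _) (hle _ _) 2
  have key := piP_fPenalty_le μ N h hmeas hnn hdiag A hA hA0 u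
  rcases le_total (u / (4 * N * I)) (1 / S) with hcase | hcase
  · refine (key (u / (4 * N * I)) (by positivity) (fun x y => ?_) hint).trans ?_
    · calc u / (4 * N * I) * h x y ≤ 1 / S * S :=
            mul_le_mul hcase (hle x y) (hnn x y) (by positivity)
        _ = 1 := one_div_mul_cancel hSpos.ne'
    · gcongr
      refine (min_le_left _ _).trans (le_of_eq ?_)
      rw [← hIdef]
      field_simp
      ring
  · refine (key (1 / S) (by positivity) (fun x y => ?_) hint).trans ?_
    · calc 1 / S * h x y ≤ 1 / S * S := by gcongr; exact hle x y
        _ = 1 := one_div_mul_cancel hSpos.ne'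
    · gcongr
      refine (min_le_right _ _).trans ?_
      rw [← hIdef]
      rw [div_le_div_iff₀ hSpos (by positivity)] at hcase
      rw [div_le_iff₀ (by positivity)]
      have : (1 / S * u - 2 * N * (1 / S) ^ 2 * I) * (2 * S) = 2 * u - 4 * N * I / S := by
        field_simp
        ring
      rw [this]
      have : 4 * N * I / S ≤ u := by rw [div_le_iff₀ hSpos]; linarith
      linarith
end
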